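/- arXiv:1710.07699 — 2 statements merged into one kernel-verified Lean document; each statement's English description precedes it below -/
import Mathlib

section
/- The determinant of the unoriented incidence matrix of an odd saturated forest with κ connected components equals ±2^κ. -/
/-- A finite multigraph: loops and multiple edges are allowed.  Each edge `e`
has two (possibly equal) endpoints `fst e` and `snd e`. -/
structure Multigraph where
  V : Type
  E : Type
  [fintV : Fintype V]
  [fintE : Fintype E]
  [decV : DecidableEq V]
  fst : E → V
  snd : E → V

attribute [instance] Multigraph.fintV Multigraph.fintE Multigraph.decV

namespace Multigraph

/-- The unoriented incidence matrix: entry `1` for an incidence of a non-loop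
edge, `2` for a loop at the vertex, `0` otherwise. -/
def inc (G : Multigraph) : Matrix G.V G.E ℚ := fun v e =>
  (if G.fst e = v then 1 else 0) + (if G.snd e = v then 1 else 0)

/-- A cycle of length `l ≥ 1` in a multigraph: distinct vertices `c 0, …, c (l-1)`
and distinct edges `f 0, …, f (l-1)`, edge `f i` joining `c i` and `c (i+1)`.
A loop is a cycle of length `1`, two parallel edges form a cycle of length `2`. -/
def IsCycle (G : Multigraph) (l : ℕ) (c : ZMod l → G.V) (f : ZMod l → G.E) : Prop :=
  0 < l ∧ Function.Injective c ∧ Function.Injective f ∧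
    ∀ i, (G.fst (f i) = c i ∧ G.snd (f i) = c (i + 1)) ∨
      (G.fst (f i) = c (i + 1) ∧ G.snd (f i) = c i)

/-- Adjacency via some edge. -/
def Adj (G : Multigraph) (u v : G.V) : Prop :=
  ∃ e, (G.fst e = u ∧ G.snd e = v) ∨ (G.fst e = v ∧ G.snd e = u)

/-- The setoid of connected components. -/
def compSetoid (G : Multigraph) : Setoid G.V :=
  ⟨Relation.EqvGen G.Adj, Relation.EqvGen.is_equivalence _⟩

/-- The connected components of `G`. -/
def Comp (G : Multigraph) : Type := Quotient G.compSetoid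

/-- Number of connected components. -/
noncomputable def numComp (G : Multigraph) : ℕ := Nat.card G.Comp

/-- `G` is a saturated forest iff every connected component has equally many
vertices and edges (equivalently: every component contains exactly one cycle). -/
def IsSaturatedForest (G : Multigraph) : Prop :=
  ∀ K : G.Comp,
    Nat.card {v : G.V // Quotient.mk G.compSetoid v = K} =
      Nat.card {e : G.E // Quotient.mk G.compSetoid (G.fst e) = K}

/-- `G` contains no even cycle. -/
def NoEvenCycle (G : Multigraph) : Prop :=
  ∀ l c f, G.IsCycle l c f → Odd l

/-- An odd saturated forest: every component contains exactly one cycle and all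
cycles are odd. -/
def IsOddSaturatedForest (G : Multigraph) : Prop :=
  G.IsSaturatedForest ∧ G.NoEvenCycle

end Multigraph

open Matrix Multigraph

namespace Multigraph

variable {G : Multigraph}

/-- The connected component of a vertex. -/
def comp (G : Multigraph) (v : G.V) : G.Comp := Quotient.mk G.compSetoid v

lemma comp_eq_comp {u v : G.V} : G.comp u = G.comp v ↔ Relation.EqvGen G.Adj u v :=
  Quotient.eq (r := G.compSetoid)

lemma comp_surjective (G : Multigraph) : Function.Surjective G.comp :=
  Quotient.mk_surjective

/-- The edge `e` joins `u` to `v`. -/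
def Joins (G : Multigraph) (e : G.E) (u v : G.V) : Prop :=
  (G.fst e = u ∧ G.snd e = v) ∨ (G.fst e = v ∧ G.snd e = u)

/-- A non-backtracking infinite walk runs through a cycle, whose length is the
difference of two times at which the walk visits the same vertex. -/
lemma exists_isCycle_of_walk (u : ℕ → G.V) (g : ℕ → G.E)
    (hj : ∀ n, G.Joins (g n) (u n) (u (n + 1))) (hg : ∀ n, g (n + 1) ≠ g n) :
    ∃ i l c f, u (i + l) = u i ∧ G.IsCycle l c f := by
  classical
  have hex : ∃ d, 0 < d ∧ ∃ i, u (i + d) = u i := by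
    obtain ⟨a, b, hab, h⟩ := Finite.exists_ne_map_eq_of_infinite u
    rcases lt_or_gt_of_ne hab with hlt | hlt
    · exact ⟨b - a, by omega, a, by rw [h]; congr 1; omega⟩
    · exact ⟨a - b, by omega, b, by rw [← h]; congr 1; omega⟩
  obtain ⟨hpos, i, hi⟩ := Nat.find_spec hex
  have hmin : ∀ d, 0 < d → d < Nat.find hex → ∀ i, u (i + d) ≠ u i := fun d h0 hd i h =>
    Nat.find_min hex hd ⟨h0, i, h⟩
  generalize Nat.find hex = l at *
  have : NeZero l := ⟨hpos.ne'⟩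
  have hinj : ∀ a b, a < b → b < l → u (i + a) ≠ u (i + b) := fun a b hab hb h =>
    hmin (b - a) (by omega) (by omega) (i + a) (by rw [h]; congr 1; omega)
  have ginj : ∀ a b, a < b → b < l → g (i + a) ≠ g (i + b) := by
    intro a b hab hb h
    have h1 := hj (i + a)
    have h2 := hj (i + b)
    rw [h] at h1
    have hne := hinj a b hab hb
    have hswap : u (i + a + 1) = u (i + b) := by
      rcases h1 with h1 | h1 <;> rcases h2 with h2 | h2
      · exact absurd (h1.1.symm.trans h2.1) hne
      · exact h1.2.symm.trans h2.2
      · exact h1.1.symm.trans h2.1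
      · exact absurd (h1.2.symm.trans h2.2) hne
    obtain rfl | hlt : a + 1 = b ∨ a + 1 < b := by omega
    · exact hg (i + a) h.symm
    · exact hinj (a + 1) b hlt hb hswap
  refine ⟨i, l, fun k => u (i + k.val), fun k => g (i + k.val), hi, hpos, ?_, ?_, ?_⟩
  · intro a b h
    apply ZMod.val_injective l
    rcases lt_trichotomy a.val b.val with hlt | heq | hlt
    · exact absurd h (hinj _ _ hlt b.val_lt)
    · exact heq
    · exact absurd h.symm (hinj _ _ hlt a.val_lt)
  · intro a b h
    apply ZMod.val_injective l
    rcases lt_trichotomy a.val b.val with hlt | heq | hlt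
    · exact absurd h (ginj _ _ hlt b.val_lt)
    · exact heq
    · exact absurd h.symm (ginj _ _ hlt a.val_lt)
  · intro k
    have hstep : u (i + (k + 1).val) = u (i + k.val + 1) := by
      have hk : (k + 1).val = (k.val + 1) % l := by
        rw [← ZMod.val_natCast]; simp
      rcases Nat.lt_or_ge (k.val + 1) l with hlt | hge
      · rw [hk, Nat.mod_eq_of_lt hlt, add_assoc]
      · have : k.val + 1 = l := le_antisymm k.val_lt hge
        rw [hk, add_assoc, this, Nat.mod_self, add_zero, hi]
    beta_reduce
    rw [hstep]
    exact hj _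

/-- If `s` is antisymmetric along edges and `S` is a nonempty set of edges without leaves on which
`s` does not vanish, then `S` carries a cycle of even length. -/
lemma exists_even_isCycle (s : G.V → ℤ) (hs : ∀ e, s (G.fst e) + s (G.snd e) = 0)
    (S : Set G.E) (hS : S.Nonempty) (hs0 : ∀ e ∈ S, s (G.fst e) ≠ 0)
    (next : ∀ e ∈ S, ∀ v, (G.fst e = v ∨ G.snd e = v) →
      ∃ e' ∈ S, e' ≠ e ∧ (G.fst e' = v ∨ G.snd e' = v)) :
    ∃ l c f, G.IsCycle l c f ∧ Even l := by
  classical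
  let P := {p : G.V × G.E // p.2 ∈ S ∧ (G.fst p.2 = p.1 ∨ G.snd p.2 = p.1)}
  have hstep : ∀ p : P, ∃ q : P, G.Joins p.1.2 p.1.1 q.1.1 ∧ q.1.2 ≠ p.1.2 := by
    rintro ⟨⟨v, e⟩, he, hv⟩
    rcases hv with hv | hv
    · obtain ⟨e', he', hne, hv'⟩ := next e he _ (Or.inr rfl)
      exact ⟨⟨(G.snd e, e'), he', hv'⟩, Or.inl ⟨hv, rfl⟩, hne⟩
    · obtain ⟨e', he', hne, hv'⟩ := next e he _ (Or.inl rfl)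
      exact ⟨⟨(G.fst e, e'), he', hv'⟩, Or.inr ⟨rfl, hv⟩, hne⟩
  choose step hj hne using hstep
  obtain ⟨e₀, he₀⟩ := hS
  let w : ℕ → P := fun n => step^[n] ⟨(G.fst e₀, e₀), he₀, Or.inl rfl⟩
  have hw : ∀ n, w (n + 1) = step (w n) := fun n => Function.iterate_succ_apply' ..
  have hjw : ∀ n, G.Joins (w n).1.2 (w n).1.1 (w (n + 1)).1.1 := fun n => by
    rw [hw]; exact hj _
  have hneg : ∀ n, s (w (n + 1)).1.1 = -s (w n).1.1 := by
    intro n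
    have := hs (w n).1.2
    rcases hjw n with ⟨h1, h2⟩ | ⟨h1, h2⟩ <;> rw [h1, h2] at this <;> linarith
  have hnz : ∀ n, s (w n).1.1 ≠ 0 := by
    intro n
    have h1 := hs (w n).1.2
    have h2 := hs0 _ (w n).2.1
    rcases (w n).2.2 with h | h
    · rwa [h] at h2
    · rw [← h]; intro h0; rw [h0, add_zero] at h1; exact h2 h1
  have hpow : ∀ i l, s (w (i + l)).1.1 = (-1) ^ l * s (w i).1.1 := by
    intro i l
    induction l with
    | zero => simp
    | succ l ih => rw [← add_assoc, hneg, ih, pow_succ]; ring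
  obtain ⟨i, l, c, f, hi, hc⟩ := exists_isCycle_of_walk (fun n => (w n).1.1) (fun n => (w n).1.2)
    hjw (fun n => by rw [hw]; exact hne _)
  refine ⟨l, c, f, hc, ?_⟩
  by_contra hodd
  have h1 := hpow i l
  have h2 := hnz i
  rw [hi, (Nat.not_even_iff_odd.mp hodd).neg_one_pow] at h1
  omega

/-- A saturated forest with a bipartite component `K`, witnessed by an antisymmetric `s` with
support `K`, contains an even cycle. -/
lemma not_noEvenCycle_of_bipartite_comp (hG : G.IsSaturatedForest) (K : G.Comp) (s : G.V → ℤ)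
    (hs : ∀ e, s (G.fst e) + s (G.snd e) = 0)
    (hsK : ∀ v, s v ≠ 0 ↔ G.comp v = K) : ¬ G.NoEvenCycle := by
  classical
  intro hodd
  have hends : ∀ e, s (G.fst e) ≠ 0 ↔ s (G.snd e) ≠ 0 := fun e => by
    have := hs e
    omega
  let VK := {v : G.V // G.comp v = K}
  let EK := {e : G.E // G.comp (G.fst e) = K}
  obtain ⟨τ⟩ : Nonempty (VK ≃ EK) := by
    rw [← Fintype.card_eq, ← Nat.card_eq_fintype_card, ← Nat.card_eq_fintype_card]
    exact hG K
  let a : G.V → G.E → ℤ := fun v e =>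
    (if G.fst e = v then 1 else 0) + (if G.snd e = v then 1 else 0)
  have ha : ∀ v e, a v e ≠ 0 ↔ G.fst e = v ∨ G.snd e = v := fun v e => by
    simp only [a]; split_ifs <;> simp_all
  let M : Matrix VK VK ℤ := Matrix.of fun v w => a v (τ w)
  have hdet : M.det = 0 := by
    rw [← Matrix.exists_vecMul_eq_zero_iff]
    obtain ⟨v₀, rfl⟩ := G.comp_surjective K
    refine ⟨fun v => s v, fun h => (hsK v₀).2 rfl (congrFun h ⟨v₀, rfl⟩), ?_⟩
    ext w
    change ∑ v : VK, s v * a v (τ w) = 0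
    calc ∑ v : VK, s v * a v (τ w)
      _ = ∑ v with s v ≠ 0, s v * a v (τ w) :=
        (Finset.sum_subtype _ (fun v => by simp [← hsK]) fun v => s v * a v (τ w)).symm
      _ = ∑ v, s v * a v (τ w) :=
        Finset.sum_filter_of_ne fun v _ h => left_ne_zero_of_mul h
      _ = 0 := by simp [a, mul_add, Finset.sum_add_distrib, hs]
  rw [← Matrix.exists_mulVec_eq_zero_iff] at hdet
  obtain ⟨x, hx, hMx⟩ := hdet
  let S : Set G.E := {e | ∃ w, x w ≠ 0 ∧ (τ w : G.E) = e}
  obtain ⟨l, c, f, hc, hl⟩ := exists_even_isCycle s hs S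
    (by
      obtain ⟨w, hw⟩ := Function.ne_iff.mp hx
      exact ⟨_, w, hw, rfl⟩)
    (by
      rintro _ ⟨w, hw, rfl⟩
      exact (hsK _).2 (τ w).2)
    (by
      rintro _ ⟨w, hw, rfl⟩ v hv
      have hvK : G.comp v = K := by
        have h := (hsK _).2 (τ w).2
        rw [← hsK]
        rcases hv with rfl | rfl
        · exact h
        · exact (hends _).1 h
      by_contra! hcon
      have hrow : ∑ w', a v (τ w') * x w' = 0 := congrFun hMx ⟨v, hvK⟩
      rw [Finset.sum_eq_single w] at hrow
      · exact mul_ne_zero ((ha _ _).2 hv) hw hrow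
      · intro w' _ hne
        by_contra hnz
        have h1 := (ha _ _).1 (left_ne_zero_of_mul hnz)
        have h2 := hcon _ ⟨w', right_ne_zero_of_mul hnz, rfl⟩
          (fun h => hne (τ.injective (Subtype.ext h)))
        tauto
      · simp)
  exact (Nat.not_even_iff_odd.mpr (hodd l c f hc)) hl

/-- The lattice spanned by the columns of the incidence matrix. -/
def colLattice (G : Multigraph) : Submodule ℤ (G.V → ℤ) :=
  Submodule.span ℤ (Set.range fun e => Pi.single (G.fst e) 1 + Pi.single (G.snd e) 1)

lemma single_add_single_mem (e : G.E) :
    (Pi.single (G.fst e) 1 + Pi.single (G.snd e) 1 : G.V → ℤ) ∈ G.colLattice :=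
  Submodule.subset_span ⟨e, rfl⟩

lemma comp_fst_eq_comp_snd (e : G.E) : G.comp (G.fst e) = G.comp (G.snd e) :=
  comp_eq_comp.2 (Relation.EqvGen.rel _ _ ⟨e, Or.inl ⟨rfl, rfl⟩⟩)

/-- In the quotient by the column lattice, vertices of one component agree up to sign. -/
lemma single_sub_or_add_mem {u v : G.V} (h : Relation.EqvGen G.Adj u v) :
    (Pi.single u 1 - Pi.single v 1 : G.V → ℤ) ∈ G.colLattice ∨
      (Pi.single u 1 + Pi.single v 1 : G.V → ℤ) ∈ G.colLattice := by
  induction h with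
  | rel u v h =>
    obtain ⟨e, ⟨rfl, rfl⟩ | ⟨rfl, rfl⟩⟩ := h
    · exact Or.inr (single_add_single_mem e)
    · exact Or.inr (by rw [add_comm]; exact single_add_single_mem e)
  | refl u => left; simp
  | symm u v _ ih =>
    refine ih.imp (fun h => ?_) (fun h => ?_)
    · simpa using neg_mem h
    · rwa [add_comm]
  | trans u v w _ _ ih₁ ih₂ =>
    rcases ih₁ with h₁ | h₁ <;> rcases ih₂ with h₂ | h₂
    · left; convert add_mem h₁ h₂ using 1; abel
    · right; convert add_mem h₁ h₂ using 1; abel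
    · right; convert sub_mem h₁ h₂ using 1; abel
    · left; convert sub_mem h₁ h₂ using 1; abel

lemma two_single_mem (hG : G.IsOddSaturatedForest) (v₀ : G.V) :
    (2 • Pi.single v₀ 1 : G.V → ℤ) ∈ G.colLattice := by
  classical
  by_contra hnot
  let d : G.V → G.V → ℤ := fun v => Pi.single v 1
  have excl : ∀ v, d v - d v₀ ∈ G.colLattice → d v + d v₀ ∈ G.colLattice → False := by
    intro v h₁ h₂
    apply hnot
    convert sub_mem h₂ h₁ using 1
    simp only [d]
    abel
  let s : G.V → ℤ := fun v =>
    if G.comp v = G.comp v₀ then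
      if d v - d v₀ ∈ G.colLattice then 1 else -1
    else 0
  refine not_noEvenCycle_of_bipartite_comp hG.1 (G.comp v₀) s ?_ ?_ hG.2
  · intro e
    have he : d (G.fst e) + d (G.snd e) ∈ G.colLattice := single_add_single_mem e
    simp only [s, ← comp_fst_eq_comp_snd e]
    by_cases hK : G.comp (G.fst e) = G.comp v₀
    · simp only [hK, if_true]
      split_ifs with h₁ h₂ h₂
      · exact (excl _ h₂ (by convert sub_mem he h₁ using 1; abel)).elim
      · rfl
      · rfl
      · exfalso
        rcases single_sub_or_add_mem (comp_eq_comp.1 hK) with h | h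
        · exact h₁ h
        · exact h₂ (by convert sub_mem he h using 1; simp only [d]; abel)
    · simp [hK]
  · intro v
    simp only [s]
    split_ifs <;> simp_all

lemma single_sub_single_mem (hG : G.IsOddSaturatedForest) {u v : G.V}
    (h : Relation.EqvGen G.Adj u v) :
    (Pi.single u 1 - Pi.single v 1 : G.V → ℤ) ∈ G.colLattice := by
  rcases single_sub_or_add_mem h with h | h
  · exact h
  · convert sub_mem h (two_single_mem hG v) using 1; rw [two_nsmul]; abel

instance : Finite G.Comp := inferInstanceAs (Finite (Quotient G.compSetoid))

open Classical in
/-- Sum of the coordinates over each component, modulo two. -/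
noncomputable def compParity (G : Multigraph) : (G.V → ℤ) →ₗ[ℤ] (G.Comp → ZMod 2) :=
  LinearMap.pi fun K => ∑ v with G.comp v = K,
    (Int.castAddHom (ZMod 2)).toIntLinearMap ∘ₗ LinearMap.proj v

lemma compParity_apply [DecidableEq G.Comp] (x : G.V → ℤ) (K : G.Comp) :
    G.compParity x K = ((∑ v with G.comp v = K, x v : ℤ) : ZMod 2) := by
  simp only [compParity, LinearMap.pi_apply, LinearMap.coe_sum, Finset.sum_apply, Int.cast_sum]
  congr!

lemma compParity_single [DecidableEq G.Comp] (v : G.V) :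
    G.compParity (Pi.single v 1) = Pi.single (G.comp v) 1 := by
  ext K
  rw [compParity_apply]
  simp [Pi.single_apply, eq_comm]

lemma ker_compParity (hG : G.IsOddSaturatedForest) :
    LinearMap.ker G.compParity = G.colLattice := by
  classical
  have := Fintype.ofFinite G.Comp
  obtain ⟨rep, hrep⟩ := G.comp_surjective.hasRightInverse
  apply le_antisymm
  · intro x hx
    have hsplit : x = ∑ v, x v • (Pi.single v 1 - Pi.single (rep (G.comp v)) 1) +
        ∑ K : G.Comp, (∑ v with G.comp v = K, x v) • Pi.single (rep K) 1 := by
      have h1 : ∑ K : G.Comp, (∑ v with G.comp v = K, x v) •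
          (Pi.single (rep K) 1 : G.V → ℤ) = ∑ v, x v • Pi.single (rep (G.comp v)) 1 := by
        rw [← Finset.sum_fiberwise (s := Finset.univ) (g := G.comp)]
        refine Fintype.sum_congr _ _ fun K => ?_
        rw [Finset.sum_smul]
        refine Finset.sum_congr rfl fun v hv => ?_
        rw [← (Finset.mem_filter.mp hv).2]
      rw [h1, ← Finset.sum_add_distrib]
      simp_rw [smul_sub, sub_add_cancel]
      exact pi_eq_sum_univ' x
    rw [hsplit]
    refine add_mem (sum_mem fun v _ => Submodule.smul_mem _ _ (single_sub_single_mem hG ?_))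
      (sum_mem fun K _ => ?_)
    · exact comp_eq_comp.1 (hrep _).symm
    · have hK := congrFun (LinearMap.mem_ker.mp hx) K
      rw [compParity_apply, Pi.zero_apply, ZMod.intCast_zmod_eq_zero_iff_dvd] at hK
      obtain ⟨m, hm⟩ := hK
      rw [hm, mul_comm, mul_smul]
      refine Submodule.smul_mem _ _ ?_
      convert two_single_mem hG (rep K) using 1
      simp
  · rw [colLattice, Submodule.span_le]
    rintro _ ⟨e, rfl⟩
    simp only [SetLike.mem_coe, LinearMap.mem_ker, map_add, compParity_single,
      comp_fst_eq_comp_snd]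
    ext K
    simp only [Pi.add_apply, Pi.zero_apply]
    exact CharTwo.add_self_eq_zero _

lemma compParity_surjective (G : Multigraph) : Function.Surjective G.compParity := by
  classical
  have := Fintype.ofFinite G.Comp
  obtain ⟨rep, hrep⟩ := G.comp_surjective.hasRightInverse
  intro y
  refine ⟨∑ K : G.Comp, ((y K).val : ℤ) • Pi.single (rep K) 1, ?_⟩
  simp only [map_sum, map_smul, compParity_single]
  ext K
  simp only [Finset.sum_apply, Pi.smul_apply, hrep _, Pi.single_apply]
  simp

lemma card_quotient_colLattice (hG : G.IsOddSaturatedForest) :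
    Nat.card ((G.V → ℤ) ⧸ G.colLattice) = 2 ^ G.numComp := by
  rw [← ker_compParity hG,
    Nat.card_congr (G.compParity.quotKerEquivOfSurjective G.compParity_surjective).toEquiv,
    Nat.card_fun, Nat.card_zmod, numComp]

end Multigraph

/-- The absolute value of a nonzero determinant is the index of the lattice of columns. -/
lemma Matrix.natAbs_det_eq_card_quotient {n : Type*} [Fintype n] [DecidableEq n]
    (A : Matrix n n ℤ) (hA : A.det ≠ 0) :
    A.det.natAbs = Nat.card ((n → ℤ) ⧸ LinearMap.range A.mulVecLin) := by
  have hinj : Function.Injective A.mulVecLin := by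
    rw [← LinearMap.ker_eq_bot, LinearMap.ker_eq_bot']
    exact fun x hx => Matrix.eq_zero_of_mulVec_eq_zero hA hx
  rw [← Submodule.natAbs_det_equiv _ (LinearEquiv.ofInjective _ hinj), ← LinearMap.det_toLin']
  rfl

/-- The determinant of the unoriented incidence matrix of an odd saturated forest
with `κ` connected components is `±2^κ`.  (The columns are matched to the rows by
an arbitrary bijection `σ`, which only affects the sign.) -/
theorem det_incidence_odd_saturated_forest (G : Multigraph)
    (hG : G.IsOddSaturatedForest) (σ : G.V ≃ G.E) :
    (Matrix.of fun u v : G.V => G.inc u (σ v)).det = 2 ^ G.numComp ∨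
      (Matrix.of fun u v : G.V => G.inc u (σ v)).det = -(2 ^ G.numComp) := by
  classical
  let A : Matrix G.V G.V ℤ := Matrix.of fun u v =>
    (if G.fst (σ v) = u then 1 else 0) + (if G.snd (σ v) = u then 1 else 0)
  have hcast : (Matrix.of fun u v : G.V => G.inc u (σ v)).det = (A.det : ℚ) := by
    rw [← eq_intCast (Int.castRingHom ℚ), RingHom.map_det]
    congr 1
    ext u v
    simp [A, inc]
  have hrange : LinearMap.range A.mulVecLin = G.colLattice := by
    rw [Matrix.range_mulVecLin, colLattice, ← σ.surjective.range_comp]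
    congr 2
    ext v u
    simp [A, Pi.single_apply, eq_comm]
  have hdet : A.det ≠ 0 := by
    intro h0
    obtain ⟨y, hy, hyA⟩ := Matrix.exists_vecMul_eq_zero_iff.2 h0
    refine hy (funext fun v => ?_)
    have hv := two_single_mem hG v
    rw [← hrange] at hv
    obtain ⟨z, hz⟩ := hv
    have h := Matrix.dotProduct_mulVec y A z
    rw [hyA, zero_dotProduct, ← Matrix.mulVecLin_apply, hz] at h
    rw [two_nsmul, dotProduct_add, dotProduct_single, mul_one] at h
    change y v = 0
    omega
  have habs := A.natAbs_det_eq_card_quotient hdet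
  rw [hrange, card_quotient_colLattice hG] at habs
  rw [hcast]
  rcases Int.natAbs_eq A.det with h | h <;> rw [h, habs]
  · left; simp
  · right; simp
end

section
/- Let L be a self-adjoint operator bounded below with smallest eigenvalue λ_0 = 0 attained, acting on L² of a metric graph by −y'' + q y with standard (Kirchhoff) conditions. If ∫_G q = 0 and 0 is the smallest eigenvalue of L, then q = 0 almost everywhere on G, and the constant function 1 is an eigenfunction for eigenvalue 0. -/
open MeasureTheory Finset

section

variable {V : Type} [Fintype V] [DecidableEq V] {N : ℕ}

/-- `(y, y')` is a solution of `-y'' + q y = μ y` (in Carathéodory integral form)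
on every edge of the metric graph with vertex set `V`, edges `Fin N` parametrized
by `[0,1]`, endpoint maps `fst`, `snd` and edge potentials `q`, satisfying the
standard (continuity + Kirchhoff) matching conditions. -/
def IsStandardSolution (fst snd : Fin N → V) (q : Fin N → ℝ → ℝ) (μ : ℝ)
    (y y' : Fin N → ℝ → ℝ) : Prop :=
  (∀ e, ∀ x ∈ Set.Icc (0:ℝ) 1, y e x = y e 0 + ∫ t in (0:ℝ)..x, y' e t) ∧
  (∀ e, ∀ x ∈ Set.Icc (0:ℝ) 1,
    y' e x = y' e 0 + ∫ t in (0:ℝ)..x, (q e t - μ) * y e t) ∧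
  -- continuity at vertices: the edge-end values come from a vertex function
  (∃ Y : V → ℝ, ∀ e, y e 0 = Y (fst e) ∧ y e 1 = Y (snd e)) ∧
  -- Kirchhoff condition at every vertex
  (∀ v : V, ∑ e ∈ univ.filter (fun e => fst e = v), y' e 0 =
    ∑ e ∈ univ.filter (fun e => snd e = v), y' e 1)

/-- `μ` is an eigenvalue: there is a nonzero standard solution. -/
def IsEigenvalue (fst snd : Fin N → V) (q : Fin N → ℝ → ℝ) (μ : ℝ) : Prop :=
  ∃ y y', IsStandardSolution fst snd q μ y y' ∧
    ∃ e, ∃ x ∈ Set.Icc (0:ℝ) 1, y e x ≠ 0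

end

/-- A linear differential equation `u' = A u` in a Banach space, with `A` continuous, has a
solution on `[0, 1]` with any prescribed initial value. -/
theorem exists_linear_ode_solution {F : Type*} [NormedAddCommGroup F] [NormedSpace ℝ F]
    [CompleteSpace F] (A : ℝ → F →L[ℝ] F) (hA : Continuous A) (u₀ : F) :
    ∃ u : ℝ → F, Continuous u ∧ u 0 = u₀ ∧ ∀ x ∈ Set.Icc (0 : ℝ) 1, HasDerivAt u (A x (u x)) x := by
  obtain ⟨M, hM⟩ := isCompact_Icc.exists_bound_of_continuousOn
    (s := Set.Icc (0 : ℝ) 1) hA.continuousOn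
  set l : ℝ := 2 * (|M| + 1) with hl
  have hl0 : 0 < l := by positivity
  have hMl : ∀ x ∈ Set.Icc (0 : ℝ) 1, ‖A x‖ ≤ l / 2 := fun x hx =>
    (hM x hx).trans (by rw [hl]; linarith [le_abs_self M])
  have hext (w : C(Set.Icc (0 : ℝ) 1, F)) :
      Continuous fun t => A t (Real.exp (l * t) • Set.IccExtend zero_le_one w t) :=
    hA.clm_apply (by fun_prop)
  let U (w : C(Set.Icc (0 : ℝ) 1, F)) (x : ℝ) : F :=
    u₀ + ∫ t in (0 : ℝ)..x, A t (Real.exp (l * t) • Set.IccExtend zero_le_one w t)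
  have hU (w) (x : ℝ) :
      HasDerivAt (U w) (A x (Real.exp (l * x) • Set.IccExtend zero_le_one w x)) x :=
    ((hext w).integral_hasStrictDerivAt 0 x).hasDerivAt.const_add u₀
  have hUc (w) : Continuous (U w) := continuous_iff_continuousAt.2 fun x => (hU w x).continuousAt
  let T (w : C(Set.Icc (0 : ℝ) 1, F)) : C(Set.Icc (0 : ℝ) 1, F) :=
    ⟨fun x => Real.exp (-(l * x)) • U w x, by
      have := hUc w
      fun_prop⟩
  have hT : ContractingWith (1 / 2) T := by
    refine ⟨by norm_num, LipschitzWith.of_dist_le_mul fun w v => ?_⟩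
    rw [ContinuousMap.dist_le (by positivity)]
    intro x
    have hx := x.2
    have hle : ‖∫ t in (0 : ℝ)..x, (A t (Real.exp (l * t) • Set.IccExtend zero_le_one w t) -
        A t (Real.exp (l * t) • Set.IccExtend zero_le_one v t))‖ ≤
        ∫ t in (0 : ℝ)..x, l / 2 * dist w v * Real.exp (l * t) := by
      refine intervalIntegral.norm_integral_le_of_norm_le hx.1 (ae_of_all _ fun t ht => ?_)
        (Continuous.intervalIntegrable (by fun_prop) _ _)
      have ht' : t ∈ Set.Icc (0 : ℝ) 1 := ⟨ht.1.le, ht.2.trans hx.2⟩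
      rw [← map_sub, ← smul_sub]
      refine ((A t).le_opNorm _).trans ?_
      rw [norm_smul, Set.IccExtend_of_mem _ _ ht', Set.IccExtend_of_mem _ _ ht', ← dist_eq_norm,
        Real.norm_of_nonneg (Real.exp_pos _).le]
      have h1 := hMl t ht'
      have h2 := ContinuousMap.dist_apply_le_dist (f := w) (g := v) ⟨t, ht'⟩
      calc _ ≤ l / 2 * (Real.exp (l * t) * dist w v) := by gcongr
        _ = _ := by ring
    have hint : ∫ t in (0 : ℝ)..x, l / 2 * dist w v * Real.exp (l * t) =
        1 / 2 * dist w v * (Real.exp (l * x) - 1) := by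
      rw [intervalIntegral.integral_const_mul, intervalIntegral.integral_comp_mul_left _ hl0.ne',
        integral_exp]
      simp only [mul_zero, Real.exp_zero, smul_eq_mul]
      field_simp
    have hsub : U w x - U v x = ∫ t in (0 : ℝ)..x,
        (A t (Real.exp (l * t) • Set.IccExtend zero_le_one w t) -
        A t (Real.exp (l * t) • Set.IccExtend zero_le_one v t)) := by
      rw [intervalIntegral.integral_sub ((hext w).intervalIntegrable _ _)
        ((hext v).intervalIntegrable _ _)]
      simp only [U]
      abel
    change dist (Real.exp (-(l * x)) • U w x) (Real.exp (-(l * x)) • U v x) ≤ _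
    rw [dist_eq_norm, ← smul_sub, norm_smul, hsub, Real.norm_of_nonneg (Real.exp_pos _).le]
    rw [hint] at hle
    calc _ ≤ Real.exp (-(l * x)) * (1 / 2 * dist w v * (Real.exp (l * x) - 1)) := by gcongr
      _ = 1 / 2 * dist w v * (1 - Real.exp (-(l * x))) := by
        rw [Real.exp_neg]
        field_simp
      _ ≤ 1 / 2 * dist w v * 1 := by
        gcongr
        linarith [Real.exp_pos (-(l * x))]
      _ = _ := by simp
  have hfix := hT.fixedPoint_isFixedPt
  set w := ContractingWith.fixedPoint T hT
  refine ⟨U w, hUc w, by simp [U], fun x hx => ?_⟩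
  have hw : w ⟨x, hx⟩ = Real.exp (-(l * x)) • U w x :=
    (DFunLike.congr_fun hfix (⟨x, hx⟩ : Set.Icc (0 : ℝ) 1)).symm
  have := hU w x
  rwa [Set.IccExtend_of_mem _ _ hx, hw, smul_smul, ← Real.exp_add, add_neg_cancel, Real.exp_zero,
    one_smul] at this

/-- `(z, p)` solves `z' = p / φ²`, `p' = (-μ - K - w²) φ² z` on `[0, 1]`. When `φ' = w φ` and
`w' = q + K`, this says that `φ z` solves `-y'' + q y = μ y`. -/
def IsReducedSolution (w φ : ℝ → ℝ) (K μ : ℝ) (z p : ℝ → ℝ) : Prop :=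
  ∀ x ∈ Set.Icc (0 : ℝ) 1, HasDerivAt z (p x / φ x ^ 2) x ∧
    HasDerivAt p ((-μ - K - w x ^ 2) * φ x ^ 2 * z x) x

theorem IsReducedSolution.linear_combination {w φ : ℝ → ℝ} {K μ : ℝ} {z₁ p₁ z₂ p₂ : ℝ → ℝ}
    (h₁ : IsReducedSolution w φ K μ z₁ p₁) (h₂ : IsReducedSolution w φ K μ z₂ p₂) (a b : ℝ) :
    IsReducedSolution w φ K μ (fun x => a * z₁ x + b * z₂ x) (fun x => a * p₁ x + b * p₂ x) := by
  intro x hx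
  refine ⟨(((h₁ x hx).1.const_mul a).add ((h₂ x hx).1.const_mul b)).congr_deriv (by ring),
    (((h₁ x hx).2.const_mul a).add ((h₂ x hx).2.const_mul b)).congr_deriv (by ring)⟩

/-- Solutions with fixed initial data exist and depend continuously on the spectral parameter. -/
theorem exists_continuous_isReducedSolution {J : Type*} [TopologicalSpace J] [CompactSpace J]
    (m : C(J, ℝ)) {w φ : ℝ → ℝ} (hw : Continuous w) (hφ : Continuous φ) (hφ0 : ∀ x, 0 < φ x)
    (K z₀ p₀ : ℝ) :
    ∃ z p : J → ℝ → ℝ, (Continuous fun s : J × ℝ => z s.1 s.2) ∧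
      (Continuous fun s : J × ℝ => p s.1 s.2) ∧
      ∀ j, z j 0 = z₀ ∧ p j 0 = p₀ ∧ IsReducedSolution w φ K (m j) (z j) (p j) := by
  let F := C(J, ℝ) × C(J, ℝ)
  let P₁ : F →L[ℝ] F := (ContinuousLinearMap.snd ℝ _ _).prod 0
  let P₂ : F →L[ℝ] F := (0 : F →L[ℝ] C(J, ℝ)).prod (ContinuousLinearMap.fst ℝ _ _)
  let P₃ : F →L[ℝ] F := (0 : F →L[ℝ] C(J, ℝ)).prod
    ((ContinuousLinearMap.mul ℝ C(J, ℝ) m).comp (ContinuousLinearMap.fst ℝ _ _))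
  have hα : Continuous fun x => 1 / φ x ^ 2 :=
    continuous_const.div (hφ.pow 2) fun x => (pow_pos (hφ0 x) 2).ne'
  obtain ⟨u, huc, hu0, hu⟩ := exists_linear_ode_solution
    (fun x => (1 / φ x ^ 2) • P₁ + ((-K - w x ^ 2) * φ x ^ 2) • P₂ - (φ x ^ 2) • P₃)
    (by fun_prop) (ContinuousMap.const J z₀, ContinuousMap.const J p₀)
  refine ⟨fun j x => (u x).1 j, fun j x => (u x).2 j, ?_, ?_, fun j => ⟨by simp [hu0],
    by simp [hu0], fun x hx => ?_⟩⟩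
  · exact (continuous_fst.comp (huc.comp continuous_snd)).eval continuous_fst
  · exact (continuous_snd.comp (huc.comp continuous_snd)).eval continuous_fst
  · have h₁ := ((ContinuousMap.evalCLM ℝ j).comp
      (ContinuousLinearMap.fst ℝ C(J, ℝ) C(J, ℝ))).hasFDerivAt.comp_hasDerivAt x (hu x hx)
    have h₂ := ((ContinuousMap.evalCLM ℝ j).comp
      (ContinuousLinearMap.snd ℝ C(J, ℝ) C(J, ℝ))).hasFDerivAt.comp_hasDerivAt x (hu x hx)
    refine ⟨h₁.congr_deriv ?_, h₂.congr_deriv ?_⟩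
    · simp [P₁, P₂, P₃, div_eq_inv_mul]
    · simp [P₁, P₂, P₃]
      ring

/-- A continuous family of injective endomorphisms of `ℝ^ι` has continuous solutions. -/
theorem exists_continuous_forall_apply_eq {J ι : Type*} [TopologicalSpace J] [Fintype ι]
    [DecidableEq ι] (L : J → (ι → ℝ) →ₗ[ℝ] (ι → ℝ)) (hL : ∀ ξ, Continuous fun j => L j ξ)
    (hinj : ∀ j ξ, L j ξ = 0 → ξ = 0) (b : ι → ℝ) :
    ∃ ξ : J → ι → ℝ, Continuous ξ ∧ ∀ j, L j (ξ j) = b := by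
  have hc : Continuous fun j => LinearMap.toMatrix' (L j) := by
    refine continuous_matrix fun i k => ?_
    simp only [LinearMap.toMatrix'_apply]
    exact (continuous_apply i).comp (hL _)
  have hdet : ∀ j, (LinearMap.toMatrix' (L j)).det ≠ 0 := by
    intro j h
    obtain ⟨v, hv, h0⟩ := Matrix.exists_mulVec_eq_zero_iff.2 h
    exact hv (hinj j v (by rw [← h0, LinearMap.toMatrix'_mulVec]))
  refine ⟨fun j => (LinearMap.toMatrix' (L j)).det⁻¹ •
    (LinearMap.toMatrix' (L j)).adjugate.mulVec b,
    (hc.matrix_det.inv₀ hdet).smul (hc.matrix_adjugate.matrix_mulVec continuous_const),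
    fun j => ?_⟩
  rw [map_smul, ← LinearMap.toMatrix'_mulVec, Matrix.mulVec_mulVec, Matrix.mul_adjugate,
    Matrix.smul_mulVec, Matrix.one_mulVec, smul_smul, inv_mul_cancel₀ (hdet j), one_smul]

/-- `φ` is a positive solution of `φ'' = (q + K + w²) φ` on `[0, 1]` with logarithmic derivative
`w`, equal to `1` at both endpoints and with nonpositive outgoing derivatives there. -/
structure IsGauge (q : ℝ → ℝ) (K : ℝ) (w φ : ℝ → ℝ) : Prop where
  continuous_w : Continuous w
  pos : ∀ x, 0 < φ x
  hasDerivAt : ∀ x, HasDerivAt φ (w x * φ x) x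
  left : φ 0 = 1
  right : φ 1 = 1
  w_eq : ∀ x ∈ Set.Icc (0 : ℝ) 1, w x = w 0 + (∫ t in (0 : ℝ)..x, q t) + K * x
  w_left : w 0 ≤ 0
  w_right : 0 ≤ w 1

theorem IsGauge.continuous {q : ℝ → ℝ} {K : ℝ} {w φ : ℝ → ℝ} (h : IsGauge q K w φ) :
    Continuous φ :=
  continuous_iff_continuousAt.2 fun x => (h.hasDerivAt x).continuousAt

theorem exists_isGauge {q : ℝ → ℝ} (hq : IntegrableOn q (Set.Icc 0 1)) :
    ∃ K₀ : ℝ, ∀ K ≥ K₀, ∃ w φ, IsGauge q K w φ := by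
  let f := (Set.Icc (0 : ℝ) 1).indicator q
  have hf : Integrable f := (integrable_indicator_iff measurableSet_Icc).2 hq
  let Q : ℝ → ℝ := fun x => ∫ t in (0 : ℝ)..x, f t
  have hQ : Continuous Q := intervalIntegral.continuous_primitive
    (fun a b => hf.intervalIntegrable) 0
  have hQ0 : Q 0 = 0 := by simp [Q]
  have hQq : ∀ x ∈ Set.Icc (0 : ℝ) 1, Q x = ∫ t in (0 : ℝ)..x, q t := by
    intro x hx
    refine intervalIntegral.integral_congr fun t ht => ?_
    rw [Set.uIcc_of_le hx.1] at ht
    exact Set.indicator_of_mem (s := Set.Icc (0 : ℝ) 1) ⟨ht.1, ht.2.trans hx.2⟩ q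
  set c := ∫ x in (0 : ℝ)..1, Q x with hc
  refine ⟨max (-2 * c) (2 * (c - Q 1)), fun K hK => ?_⟩
  let w : ℝ → ℝ := fun x => Q x - c + K * (x - 1 / 2)
  have hw : Continuous w := by fun_prop
  have hw1 : ∫ x in (0 : ℝ)..1, w x = 0 := by
    simp only [w]
    rw [intervalIntegral.integral_add (f := fun x => Q x - c) (g := fun x => K * (x - 1 / 2))
      (Continuous.intervalIntegrable (by fun_prop) _ _)
      (Continuous.intervalIntegrable (by fun_prop) _ _),
      intervalIntegral.integral_sub (hQ.intervalIntegrable _ _) (by simp), ← hc,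
      intervalIntegral.integral_const_mul, intervalIntegral.integral_sub (by simp) (by simp)]
    simp
  have h1 := (le_max_left _ _).trans hK
  have h2 := (le_max_right _ _).trans hK
  refine ⟨w, fun x => Real.exp (∫ t in (0 : ℝ)..x, w t), hw, fun x => Real.exp_pos _,
    fun x => ?_, by simp, by simp [hw1], fun x hx => ?_, ?_, ?_⟩
  · exact ((hw.integral_hasStrictDerivAt 0 x).hasDerivAt.exp).congr_deriv (mul_comm _ _)
  · rw [← hQq x hx]
    simp only [w, hQ0]
    ring
  · simp only [w, hQ0]
    linarith
  · simp only [w]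
    linarith

/-- Integration by parts for the primitive of an integrable function against a `C¹` function. -/
theorem integral_mul_add_primitive_mul {f G g : ℝ → ℝ} {a b : ℝ} (hab : a ≤ b)
    (hf : IntervalIntegrable f volume a b) (hG : ∀ x ∈ Set.Icc a b, HasDerivAt G (g x) x)
    (hg : ContinuousOn g (Set.Icc a b)) :
    ∫ x in a..b, (f x * G x + (∫ t in a..x, f t) * g x) = (∫ t in a..b, f t) * G b := by
  have hF := hf.absolutelyContinuousOnInterval_intervalIntegral (c := a) Set.left_mem_uIcc
  obtain ⟨C, hC⟩ := isCompact_Icc.exists_bound_of_continuousOn hg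
  have hGa : AbsolutelyContinuousOnInterval G a b := by
    refine LipschitzOnWith.absolutelyContinuousOnInterval (K := C.toNNReal) ?_
    rw [Set.uIcc_of_le hab]
    refine (convex_Icc a b).lipschitzOnWith_of_nnnorm_hasDerivWithin_le
      (fun x hx => (hG x hx).hasDerivWithinAt) fun x hx => ?_
    rw [← NNReal.coe_le_coe, coe_nnnorm]
    exact (hC x hx).trans (Real.le_coe_toNNReal C)
  have := hF.integral_deriv_mul_eq_sub hGa
  rw [intervalIntegral.integral_same, zero_mul, sub_zero] at this
  rw [← this]
  refine intervalIntegral.integral_congr_ae ?_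
  filter_upwards [hf.ae_hasDerivAt_integral] with x hx hxab
  have hx' := Set.uIoc_subset_uIcc hxab
  rw [(hx hx' a Set.left_mem_uIcc).deriv, (hG x (by rwa [Set.uIcc_of_le hab] at hx')).deriv]

namespace IsReducedSolution

variable {q w φ z p : ℝ → ℝ} {K μ : ℝ}

theorem continuousOn_fst (h : IsReducedSolution w φ K μ z p) :
    ContinuousOn z (Set.Icc 0 1) := fun x hx => (h x hx).1.continuousAt.continuousWithinAt

theorem continuousOn_snd (h : IsReducedSolution w φ K μ z p) :
    ContinuousOn p (Set.Icc 0 1) := fun x hx => (h x hx).2.continuousAt.continuousWithinAt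

theorem gauge_mul_eq_integral (hG : IsGauge q K w φ)
    (h : IsReducedSolution w φ K μ z p) {x : ℝ} (hx : x ∈ Set.Icc (0 : ℝ) 1) :
    φ x * z x = φ 0 * z 0 + ∫ t in (0 : ℝ)..x, (w t * (φ t * z t) + p t / φ t) := by
  have hsub : Set.Icc 0 x ⊆ Set.Icc (0 : ℝ) 1 := Set.Icc_subset_Icc_right hx.2
  have hz := h.continuousOn_fst.mono hsub
  have hp := h.continuousOn_snd.mono hsub
  have hφ := hG.continuous
  have hw := hG.continuous_w
  have hcont : ContinuousOn (fun t => w t * (φ t * z t) + p t / φ t) (Set.Icc 0 x) :=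
    (hw.continuousOn.mul (hφ.continuousOn.mul hz)).add
      (hp.div hφ.continuousOn fun t _ => (hG.pos t).ne')
  rw [intervalIntegral.integral_eq_sub_of_hasDerivAt (f := fun t => φ t * z t)]
  · ring
  · intro t ht
    rw [Set.uIcc_of_le hx.1] at ht
    refine ((hG.hasDerivAt t).mul (h t (hsub ht)).1).congr_deriv ?_
    have := (hG.pos t).ne'
    field_simp
  · exact hcont.intervalIntegrable_of_Icc hx.1

theorem gauge_deriv_eq_integral (hq : IntegrableOn q (Set.Icc 0 1)) (hG : IsGauge q K w φ)
    (h : IsReducedSolution w φ K μ z p) {x : ℝ} (hx : x ∈ Set.Icc (0 : ℝ) 1) :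
    w x * (φ x * z x) + p x / φ x = w 0 * (φ 0 * z 0) + p 0 / φ 0 +
      ∫ t in (0 : ℝ)..x, (q t - μ) * (φ t * z t) := by
  have hsub : Set.Icc 0 x ⊆ Set.Icc (0 : ℝ) 1 := Set.Icc_subset_Icc_right hx.2
  have hz := h.continuousOn_fst.mono hsub
  have hp := h.continuousOn_snd.mono hsub
  have hφ := hG.continuous
  have hw := hG.continuous_w
  have hφ0 := fun t => (hG.pos t).ne'
  have hqx : IntervalIntegrable q volume 0 x :=
    (intervalIntegrable_iff_integrableOn_Icc_of_le hx.1).2 (hq.mono_set hsub)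
  let y' : ℝ → ℝ := fun t => w t * (φ t * z t) + p t / φ t
  have hy'c : ContinuousOn y' (Set.Icc 0 x) :=
    (hw.continuousOn.mul (hφ.continuousOn.mul hz)).add
      (hp.div hφ.continuousOn fun t _ => (hG.pos t).ne')
  have hy : ∀ t ∈ Set.Icc (0 : ℝ) x, HasDerivAt (fun t => φ t * z t) (y' t) t := fun t ht =>
    ((hG.hasDerivAt t).mul (h t (hsub ht)).1).congr_deriv (by
      have := hφ0 t
      simp only [y']
      field_simp)
  let R : ℝ → ℝ := fun t => (w 0 + K * t) * (φ t * z t) + p t / φ t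
  let R' : ℝ → ℝ := fun t => K * (φ t * z t) + (w 0 + K * t) * y' t +
    ((-μ - K - w t ^ 2) * (φ t * z t) - w t * (p t / φ t))
  have hR : ∀ t ∈ Set.Icc (0 : ℝ) x, HasDerivAt R (R' t) t := fun t ht =>
    (((((hasDerivAt_id t).const_mul K).const_add (w 0)).mul (hy t ht)).add
      ((h t (hsub ht)).2.div (hG.hasDerivAt t) (hφ0 t))).congr_deriv (by
      have := hφ0 t
      simp only [R', id]
      field_simp)
  have hR'c : ContinuousOn R' (Set.Icc 0 x) :=
    ((continuousOn_const.mul (hφ.continuousOn.mul hz)).add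
      ((by fun_prop : ContinuousOn (fun t => w 0 + K * t) _).mul hy'c)).add
      (((by fun_prop : ContinuousOn (fun t => -μ - K - w t ^ 2) _).mul
        (hφ.continuousOn.mul hz)).sub
        (hw.continuousOn.mul (hp.div hφ.continuousOn fun t _ => hφ0 t)))
  have hR'i : IntervalIntegrable R' volume 0 x := hR'c.intervalIntegrable_of_Icc hx.1
  have hFTC : ∫ t in (0 : ℝ)..x, R' t = R x - R 0 :=
    intervalIntegral.integral_eq_sub_of_hasDerivAt
      (fun t ht => hR t (by rwa [Set.uIcc_of_le hx.1] at ht)) hR'i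
  have hparts := integral_mul_add_primitive_mul hx.1 hqx hy hy'c
  have hFi : IntervalIntegrable
      (fun t => q t * (φ t * z t) + (∫ s in (0 : ℝ)..t, q s) * y' t) volume 0 x := by
    refine (hqx.mul_continuousOn ?_).add (ContinuousOn.intervalIntegrable ?_)
    · rw [Set.uIcc_of_le hx.1]
      exact hφ.continuousOn.mul hz
    · have := intervalIntegral.continuousOn_primitive_interval' hqx Set.left_mem_uIcc
      exact this.mul (by rwa [Set.uIcc_of_le hx.1])
  have hcongr : ∫ t in (0 : ℝ)..x, (q t - μ) * (φ t * z t) = ∫ t in (0 : ℝ)..x,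
      ((q t * (φ t * z t) + (∫ s in (0 : ℝ)..t, q s) * y' t) + R' t) := by
    refine intervalIntegral.integral_congr fun t ht => ?_
    rw [Set.uIcc_of_le hx.1] at ht
    have hwt := hG.w_eq t (hsub ht)
    have : (∫ s in (0 : ℝ)..t, q s) = w t - w 0 - K * t := by linarith
    simp only [this, R', y']
    ring
  rw [hcongr, intervalIntegral.integral_add hFi hR'i, hparts, hFTC, hG.w_eq x hx]
  simp only [R]
  ring

theorem eq_zero_right (hG : IsGauge q K w φ) (h : IsReducedSolution w φ K μ z p) {x : ℝ}
    (hx : x ∈ Set.Icc (0 : ℝ) 1) (hz : z x = 0) (hp : p x = 0) : z 1 = 0 := by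
  have hsub : Set.Icc x 1 ⊆ Set.Icc (0 : ℝ) 1 := Set.Icc_subset_Icc_left hx.1
  have hφ := hG.continuous
  have hw := hG.continuous_w
  have hα : Continuous fun x => 1 / φ x ^ 2 :=
    continuous_const.div (hφ.pow 2) fun x => (pow_pos (hG.pos x) 2).ne'
  obtain ⟨C, hC⟩ := isCompact_Icc.exists_bound_of_continuousOn
    (s := Set.Icc (0 : ℝ) 1) hα.continuousOn
  obtain ⟨D, hD⟩ := isCompact_Icc.exists_bound_of_continuousOn (s := Set.Icc (0 : ℝ) 1)
    (f := fun t => (-μ - K - w t ^ 2) * φ t ^ 2) (by fun_prop)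
  have := eq_zero_of_abs_deriv_le_mul_abs_self_of_eq_zero_right (a := x) (b := 1)
    (f := fun t => (z t, p t))
    (f' := fun t => (p t / φ t ^ 2, (-μ - K - w t ^ 2) * φ t ^ 2 * z t)) (K := max C D)
    ((h.continuousOn_fst.mono hsub).prodMk (h.continuousOn_snd.mono hsub))
    (fun t ht => ((h t (hsub ⟨ht.1, ht.2.le⟩)).1.prodMk
      (h t (hsub ⟨ht.1, ht.2.le⟩)).2).hasDerivWithinAt) (by simp [hz, hp]) ?_ 1 ⟨hx.2, le_rfl⟩
  · exact congrArg Prod.fst this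
  · intro t ht
    have ht' := hsub ⟨ht.1, ht.2.le⟩
    have hC0 : 0 ≤ max C D := (norm_nonneg _).trans ((hC t ht').trans (le_max_left _ _))
    rw [Prod.norm_def, max_le_iff]
    constructor
    · rw [div_eq_mul_one_div, mul_comm, norm_mul]
      exact mul_le_mul ((hC t ht').trans (le_max_left _ _)) (norm_snd_le (z t, p t))
        (norm_nonneg _) hC0
    · rw [norm_mul]
      exact mul_le_mul ((hD t ht').trans (le_max_right _ _)) (norm_fst_le (z t, p t))
        (norm_nonneg _) hC0

theorem snd_left_nonneg (hG : IsGauge q K w φ) (h : IsReducedSolution w φ K μ z p)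
    (hz : ∀ x ∈ Set.Icc (0 : ℝ) 1, z 0 ≤ z x) : 0 ≤ p 0 := by
  have hd := (h 0 (by simp)).1
  rw [hG.left, one_pow, div_one] at hd
  have := (hasDerivWithinAt_iff_tendsto_slope' (s := Set.Ioi (0 : ℝ)) (by simp)).1
    hd.hasDerivWithinAt
  refine ge_of_tendsto this ?_
  filter_upwards [Ioo_mem_nhdsGT zero_lt_one] with x hx
  rw [slope_def_field]
  exact div_nonneg (sub_nonneg.2 (hz x ⟨hx.1.le, hx.2.le⟩)) (by linarith [hx.1])

theorem snd_right_nonpos (hG : IsGauge q K w φ) (h : IsReducedSolution w φ K μ z p)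
    (hz : ∀ x ∈ Set.Icc (0 : ℝ) 1, z 1 ≤ z x) : p 1 ≤ 0 := by
  have hd := (h 1 (by simp)).1
  rw [hG.right, one_pow, div_one] at hd
  have := (hasDerivWithinAt_iff_tendsto_slope' (s := Set.Iio (1 : ℝ)) (by simp)).1
    hd.hasDerivWithinAt
  refine le_of_tendsto this ?_
  filter_upwards [Ioo_mem_nhdsLT zero_lt_one] with x hx
  rw [slope_def_field]
  exact div_nonpos_of_nonneg_of_nonpos (sub_nonneg.2 (hz x ⟨hx.1.le, hx.2.le⟩))
    (by linarith [hx.2])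

theorem snd_eq_zero (hG : IsGauge q K w φ) (h : IsReducedSolution w φ K μ z p) {x : ℝ}
    (hx : x ∈ Set.Ioo (0 : ℝ) 1) (hz : ∀ t ∈ Set.Icc (0 : ℝ) 1, z x ≤ z t) : p x = 0 := by
  have hmin : IsLocalMin z x := by
    filter_upwards [Icc_mem_nhds hx.1 hx.2] with t ht using hz t ht
  have := hmin.hasDerivAt_eq_zero (h x ⟨hx.1.le, hx.2.le⟩).1
  simpa [(hG.pos x).ne'] using this

theorem snd_left_eq_zero (hG : IsGauge q K w φ) (h : IsReducedSolution w φ K μ z p)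
    (hz : ∀ x ∈ Set.Icc (0 : ℝ) 1, z x = 0) : p 0 = 0 := by
  refine le_antisymm ?_ (h.snd_left_nonneg hG fun x hx => by rw [hz x hx, hz 0 (by simp)])
  have := (h.linear_combination h (-1) 0).snd_left_nonneg hG
    fun x hx => by simp [hz x hx, hz 0 (by simp)]
  simpa using this

/-- If `-μ` is so large that `φ` is a strict supersolution, `z` has no negative interior minimum. -/
theorem nonneg_of_interior_min (hG : IsGauge q K w φ) (h : IsReducedSolution w φ K μ z p)
    (hμ : ∀ x ∈ Set.Icc (0 : ℝ) 1, 0 < -μ - K - w x ^ 2) {x : ℝ} (hx : x ∈ Set.Ioo (0 : ℝ) 1)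
    (hz : ∀ t ∈ Set.Icc (0 : ℝ) 1, z x ≤ z t) : 0 ≤ z x := by
  by_contra! hneg
  have hp := h.snd_eq_zero hG hx hz
  have hev : ∀ᶠ t in nhds x, z t < 0 ∧ t < 1 :=
    ((h x ⟨hx.1.le, hx.2.le⟩).1.continuousAt.eventually (gt_mem_nhds hneg)).and
      (gt_mem_nhds hx.2)
  obtain ⟨b, hxb, hb⟩ := mem_nhdsGE_iff_exists_Icc_subset.1 (mem_nhdsWithin_of_mem_nhds hev)
  have hxb : x < b := hxb
  have hmem : ∀ t ∈ Set.Icc x b, t ∈ Set.Icc (0 : ℝ) 1 := fun t ht =>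
    ⟨hx.1.le.trans ht.1, (hb ht).2.le⟩
  have hpanti : StrictAntiOn p (Set.Icc x b) := by
    refine strictAntiOn_of_deriv_neg (convex_Icc x b) (h.continuousOn_snd.mono hmem)
      fun t ht => ?_
    rw [interior_Icc] at ht
    have ht' := Set.Ioo_subset_Icc_self ht
    rw [(h t (hmem t ht')).2.deriv]
    exact mul_neg_of_pos_of_neg (mul_pos (hμ t (hmem t ht')) (pow_pos (hG.pos t) 2)) (hb ht').1
  have hzanti : StrictAntiOn z (Set.Icc x b) := by
    refine strictAntiOn_of_deriv_neg (convex_Icc x b) (h.continuousOn_fst.mono hmem)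
      fun t ht => ?_
    rw [interior_Icc] at ht
    have ht' := Set.Ioo_subset_Icc_self ht
    rw [(h t (hmem t ht')).1.deriv]
    have := hpanti (Set.left_mem_Icc.2 hxb.le) ht' ht.1
    exact div_neg_of_neg_of_pos (by linarith) (pow_pos (hG.pos t) 2)
  have hb' := Set.right_mem_Icc.2 hxb.le
  exact (hzanti (Set.left_mem_Icc.2 hxb.le) hb' hxb).not_ge (hz b (hmem b hb'))

/-- The logarithmic derivative of a positive solution satisfies the Riccati equation. -/
theorem riccati (hG : IsGauge q K w φ) (h : IsReducedSolution w φ K μ z p)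
    (hz : ∀ x ∈ Set.Icc (0 : ℝ) 1, 0 < z x) :
    ∃ W : ℝ → ℝ, ContinuousOn W (Set.Icc 0 1) ∧ W 0 = w 0 + p 0 / z 0 ∧ W 1 = w 1 + p 1 / z 1 ∧
      ∀ x ∈ Set.Icc (0 : ℝ) 1,
        W x = W 0 + (∫ t in (0 : ℝ)..x, q t) - μ * x - ∫ t in (0 : ℝ)..x, W t ^ 2 := by
  have hφ := hG.continuous
  have hne : ∀ t ∈ Set.Icc (0 : ℝ) 1, φ t ^ 2 * z t ≠ 0 := fun t ht =>
    (mul_pos (pow_pos (hG.pos t) 2) (hz t ht)).ne'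
  let W : ℝ → ℝ := fun x => w x + p x / (φ x ^ 2 * z x)
  have hW : ContinuousOn W (Set.Icc 0 1) := hG.continuous_w.continuousOn.add
    (h.continuousOn_snd.div ((hφ.pow 2).continuousOn.mul h.continuousOn_fst) hne)
  refine ⟨W, hW, by simp [W, hG.left], by simp [W, hG.right], fun x hx => ?_⟩
  have hsub : Set.Icc 0 x ⊆ Set.Icc (0 : ℝ) 1 := Set.Icc_subset_Icc_right hx.2
  have hW2 : IntervalIntegrable (fun t => W t ^ 2) volume 0 x :=
    ((hW.mono hsub).pow 2).intervalIntegrable_of_Icc hx.1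
  have hr : ∫ t in (0 : ℝ)..x, (-μ - K - W t ^ 2) =
      p x / (φ x ^ 2 * z x) - p 0 / (φ 0 ^ 2 * z 0) := by
    refine intervalIntegral.integral_eq_sub_of_hasDerivAt
      (f := fun t => p t / (φ t ^ 2 * z t)) (fun t ht => ?_) (by simp [hW2])
    rw [Set.uIcc_of_le hx.1] at ht
    have h1 := (hG.pos t).ne'
    have h2 := (hz t (hsub ht)).ne'
    refine ((h t (hsub ht)).2.div (((hG.hasDerivAt t).pow 2).mul (h t (hsub ht)).1)
      (hne t (hsub ht))).congr_deriv ?_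
    simp only [W, Pi.pow_apply, Pi.mul_apply]
    field_simp
    ring
  rw [intervalIntegral.integral_sub (by simp) hW2] at hr
  simp only [intervalIntegral.integral_const, sub_zero, smul_eq_mul] at hr
  have hwx := hG.w_eq x hx
  simp only [W] at hr ⊢
  linarith

end IsReducedSolution

section Graph

variable {V : Type} [DecidableEq V] {N : ℕ}

/-- `(z, p)` is a reduced solution on every edge, `z` takes the values `Y` at the vertices, and at
every vertex the Kirchhoff condition for `φ z` holds with a source of strength `s` for each
edge end. -/
structure IsReducedGraphSolution (fst snd : Fin N → V) (w φ : Fin N → ℝ → ℝ) (K μ s : ℝ)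
    (z p : Fin N → ℝ → ℝ) (Y : V → ℝ) : Prop where
  edge : ∀ e, IsReducedSolution (w e) (φ e) K μ (z e) (p e)
  left : ∀ e, z e 0 = Y (fst e)
  right : ∀ e, z e 1 = Y (snd e)
  kirchhoff : ∀ v, ∑ e ∈ univ.filter (fun e => fst e = v), (p e 0 + w e 0 * Y v + s) =
    ∑ e ∈ univ.filter (fun e => snd e = v), (p e 1 + w e 1 * Y v - s)

variable {fst snd : Fin N → V} {q w φ z p : Fin N → ℝ → ℝ} {K μ : ℝ} {Y : V → ℝ}

namespace IsReducedGraphSolution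

theorem isStandardSolution [Fintype V] (hq : ∀ e, IntegrableOn (q e) (Set.Icc 0 1))
    (hG : ∀ e, IsGauge (q e) K (w e) (φ e))
    (h : IsReducedGraphSolution fst snd w φ K μ 0 z p Y) :
    IsStandardSolution fst snd q μ (fun e x => φ e x * z e x)
      (fun e x => w e x * (φ e x * z e x) + p e x / φ e x) := by
  refine ⟨fun e x hx => (h.edge e).gauge_mul_eq_integral (hG e) hx,
    fun e x hx => (h.edge e).gauge_deriv_eq_integral (hq e) (hG e) hx,
    ⟨Y, fun e => ⟨by simp [(hG e).left, h.left], by simp [(hG e).right, h.right]⟩⟩, fun v => ?_⟩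
  convert h.kirchhoff v using 1
  · refine Finset.sum_congr rfl fun e he => ?_
    beta_reduce
    rw [(hG e).left, h.left, (Finset.mem_filter.1 he).2]
    ring
  · refine Finset.sum_congr rfl fun e he => ?_
    beta_reduce
    rw [(hG e).right, h.right, (Finset.mem_filter.1 he).2]
    ring

/-- A nonpositive minimum is not attained at a vertex with positive sources. -/
theorem vertex_ne (hG : ∀ e, IsGauge (q e) K (w e) (φ e))
    (h : IsReducedGraphSolution fst snd w φ K μ 1 z p Y) {m : ℝ} (hm : m ≤ 0)
    (hz : ∀ e, ∀ x ∈ Set.Icc (0 : ℝ) 1, m ≤ z e x) {v : V}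
    (hv : ∃ e, fst e = v ∨ snd e = v) : Y v ≠ m := by
  rintro rfl
  have h1 : ∀ e ∈ univ.filter (fun e => fst e = v), 0 < p e 0 + w e 0 * Y v + 1 := by
    intro e he
    have hev := (Finset.mem_filter.1 he).2
    have := (h.edge e).snd_left_nonneg (hG e) (by rw [h.left, hev]; exact hz e)
    have := mul_nonneg_of_nonpos_of_nonpos (hG e).w_left hm
    linarith
  have h2 : ∀ e ∈ univ.filter (fun e => snd e = v), p e 1 + w e 1 * Y v - 1 < 0 := by
    intro e he
    have hev := (Finset.mem_filter.1 he).2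
    have := (h.edge e).snd_right_nonpos (hG e) (by rw [h.right, hev]; exact hz e)
    have := mul_nonpos_of_nonneg_of_nonpos (hG e).w_right hm
    linarith
  have hk := h.kirchhoff v
  have h1' := Finset.sum_nonneg fun e he => (h1 e he).le
  have h2' := Finset.sum_nonpos fun e he => (h2 e he).le
  obtain ⟨e, he | he⟩ := hv
  · have := Finset.sum_pos h1 ⟨e, by simp [he]⟩
    linarith
  · have := Finset.sum_neg h2 ⟨e, by simp [he]⟩
    linarith

theorem pos_of_nonneg (hG : ∀ e, IsGauge (q e) K (w e) (φ e))
    (h : IsReducedGraphSolution fst snd w φ K μ 1 z p Y)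
    (hz : ∀ e, ∀ x ∈ Set.Icc (0 : ℝ) 1, 0 ≤ z e x) (e : Fin N) {x : ℝ}
    (hx : x ∈ Set.Icc (0 : ℝ) 1) : 0 < z e x := by
  refine (hz e x hx).lt_of_ne' fun h0 => ?_
  have hl := h.vertex_ne hG le_rfl hz ⟨e, .inl rfl⟩
  have hr := h.vertex_ne hG le_rfl hz ⟨e, .inr rfl⟩
  rw [← h.left] at hl
  rw [← h.right] at hr
  have hx0 : x ≠ 0 := fun hx0 => hl (hx0 ▸ h0)
  have hx1 : x ≠ 1 := fun hx1 => hr (hx1 ▸ h0)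
  have hp := (h.edge e).snd_eq_zero (hG e) ⟨hx.1.lt_of_ne' hx0, hx.2.lt_of_ne hx1⟩
    (by rw [h0]; exact hz e)
  exact hr ((h.edge e).eq_zero_right (hG e) hx h0 hp)

theorem exists_isMin [Nonempty (Fin N)] (h : IsReducedGraphSolution fst snd w φ K μ 1 z p Y) :
    ∃ e, ∃ x ∈ Set.Icc (0 : ℝ) 1, ∀ e', ∀ t ∈ Set.Icc (0 : ℝ) 1, z e x ≤ z e' t := by
  have hmin (e : Fin N) := isCompact_Icc.exists_isMinOn (Set.nonempty_Icc.2 zero_le_one)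
    (h.edge e).continuousOn_fst
  choose x hx hxmin using hmin
  obtain ⟨e, he⟩ := Finite.exists_min fun e => z e (x e)
  exact ⟨e, x e, hx e, fun e' t ht => (he e').trans (hxmin e' ht)⟩

theorem pos_of_supersolution (hG : ∀ e, IsGauge (q e) K (w e) (φ e))
    (h : IsReducedGraphSolution fst snd w φ K μ 1 z p Y)
    (hμ : ∀ e, ∀ x ∈ Set.Icc (0 : ℝ) 1, 0 < -μ - K - w e x ^ 2) (e : Fin N) {x : ℝ}
    (hx : x ∈ Set.Icc (0 : ℝ) 1) : 0 < z e x := by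
  refine h.pos_of_nonneg hG ?_ e hx
  have : Nonempty (Fin N) := ⟨e⟩
  obtain ⟨e₀, x₀, hx₀, hmin⟩ := h.exists_isMin
  suffices 0 ≤ z e₀ x₀ from fun e t ht => this.trans (hmin e t ht)
  by_contra! hneg
  have hl := h.vertex_ne hG hneg.le hmin ⟨e₀, .inl rfl⟩
  have hr := h.vertex_ne hG hneg.le hmin ⟨e₀, .inr rfl⟩
  rw [← h.left] at hl
  rw [← h.right] at hr
  have hx0 : x₀ ≠ 0 := by rintro rfl; exact hl rfl
  have hx1 : x₀ ≠ 1 := by rintro rfl; exact hr rfl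
  exact hneg.not_ge ((h.edge e₀).nonneg_of_interior_min (hG e₀) (hμ e₀)
    ⟨hx₀.1.lt_of_ne' hx0, hx₀.2.lt_of_ne hx1⟩ (hmin e₀))

/-- Summing the Riccati equations of a positive solution over the graph. -/
theorem exists_riccati [Fintype V] (hG : ∀ e, IsGauge (q e) K (w e) (φ e))
    (h : IsReducedGraphSolution fst snd w φ K μ 1 z p Y)
    (hz : ∀ e, ∀ x ∈ Set.Icc (0 : ℝ) 1, 0 < z e x)
    (hint : ∑ e, ∫ t in (0 : ℝ)..1, q e t = 0) :
    ∃ W : Fin N → ℝ → ℝ, (∀ e, ContinuousOn (W e) (Set.Icc 0 1)) ∧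
      (∀ e, ∀ x ∈ Set.Icc (0 : ℝ) 1, W e x = W e 0 + (∫ t in (0 : ℝ)..x, q e t) - μ * x -
        ∫ t in (0 : ℝ)..x, W e t ^ 2) ∧
      ∑ e, ∫ t in (0 : ℝ)..1, W e t ^ 2 ≤ -μ * N := by
  choose W hWc hW0 hW1 hW using fun e => (h.edge e).riccati (hG e) (hz e)
  refine ⟨W, hWc, hW, ?_⟩
  have hY : ∀ v, (∃ e, fst e = v ∨ snd e = v) → 0 < Y v := by
    rintro v ⟨e, rfl | rfl⟩
    · rw [← h.left]
      exact hz e 0 (by simp)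
    · rw [← h.right]
      exact hz e 1 (by simp)
  have hsum : ∑ e, W e 0 ≤ ∑ e, W e 1 := by
    rw [← Finset.sum_fiberwise univ fst, ← Finset.sum_fiberwise univ snd]
    refine Finset.sum_le_sum fun v _ => ?_
    by_cases hv : ∃ e, fst e = v ∨ snd e = v
    · have hYv := hY v hv
      have e1 : ∑ e ∈ univ.filter (fun e => fst e = v), W e 0 ≤
          ∑ e ∈ univ.filter (fun e => fst e = v), (p e 0 + w e 0 * Y v + 1) / Y v := by
        refine Finset.sum_le_sum fun e he => ?_
        rw [hW0, h.left, (Finset.mem_filter.1 he).2, le_div_iff₀ hYv]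
        field_simp
        linarith
      have e2 : ∑ e ∈ univ.filter (fun e => snd e = v), (p e 1 + w e 1 * Y v - 1) / Y v ≤
          ∑ e ∈ univ.filter (fun e => snd e = v), W e 1 := by
        refine Finset.sum_le_sum fun e he => ?_
        rw [hW1, h.right, (Finset.mem_filter.1 he).2, div_le_iff₀ hYv]
        field_simp
        linarith
      rw [← Finset.sum_div] at e1 e2
      rw [h.kirchhoff v] at e1
      exact e1.trans e2
    · push Not at hv
      rw [Finset.filter_false_of_mem fun e _ => (hv e).1,
        Finset.filter_false_of_mem fun e _ => (hv e).2]
      simp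
  have htot : ∑ e, W e 1 = ∑ e, W e 0 + 0 - μ * N - ∑ e, ∫ t in (0 : ℝ)..1, W e t ^ 2 := by
    rw [Finset.sum_congr rfl fun e _ => hW e 1 (by simp), Finset.sum_sub_distrib,
      Finset.sum_sub_distrib, Finset.sum_add_distrib, hint]
    simp [mul_comm]
  linarith

end IsReducedGraphSolution

open Classical in
/-- If no value of the parameter is an eigenvalue, then the problem with unit sources has a
solution depending continuously on the parameter. -/
theorem exists_continuous_isReducedGraphSolution [Fintype V] {J : Type*} [TopologicalSpace J]
    [CompactSpace J] (m : C(J, ℝ)) (hq : ∀ e, IntegrableOn (q e) (Set.Icc 0 1))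
    (hG : ∀ e, IsGauge (q e) K (w e) (φ e)) (hm : ∀ j, ¬ IsEigenvalue fst snd q (m j)) :
    ∃ (z p : J → Fin N → ℝ → ℝ) (Y : J → V → ℝ),
      (∀ e, Continuous fun s : J × ℝ => z s.1 e s.2) ∧
      ∀ j, IsReducedGraphSolution fst snd w φ K (m j) 1 (z j) (p j) (Y j) := by
  choose C D hC hD hCD using fun e => exists_continuous_isReducedSolution m (hG e).continuous_w
    (hG e).continuous (hG e).pos K 1 0
  choose S R hS hR hSR using fun e => exists_continuous_isReducedSolution m (hG e).continuous_w
    (hG e).continuous (hG e).pos K 0 1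
  let Z (ξ : V ⊕ Fin N → ℝ) (j : J) (e : Fin N) (x : ℝ) : ℝ :=
    ξ (.inl (fst e)) * C e j x + ξ (.inr e) * S e j x
  let P (ξ : V ⊕ Fin N → ℝ) (j : J) (e : Fin N) (x : ℝ) : ℝ :=
    ξ (.inl (fst e)) * D e j x + ξ (.inr e) * R e j x
  have hedge (ξ j e) : IsReducedSolution (w e) (φ e) K (m j) (Z ξ j e) (P ξ j e) :=
    (hCD e j).2.2.linear_combination (hSR e j).2.2 _ _
  have hZ0 (ξ j e) : Z ξ j e 0 = ξ (.inl (fst e)) := by simp [Z, (hCD e j).1, (hSR e j).1]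
  have hP0 (ξ j e) : P ξ j e 0 = ξ (.inr e) := by simp [P, (hCD e j).2.1, (hSR e j).2.1]
  let π (i : V ⊕ Fin N) : (V ⊕ Fin N → ℝ) →ₗ[ℝ] ℝ := LinearMap.proj i
  let Pl (j : J) (e : Fin N) (x : ℝ) : (V ⊕ Fin N → ℝ) →ₗ[ℝ] ℝ :=
    D e j x • π (.inl (fst e)) + R e j x • π (.inr e)
  let L (j : J) : (V ⊕ Fin N → ℝ) →ₗ[ℝ] (V ⊕ Fin N → ℝ) := LinearMap.pi <| Sum.elim
    (fun v => ∑ e ∈ univ.filter (fun e => fst e = v), (Pl j e 0 + w e 0 • π (.inl v)) -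
      ∑ e ∈ univ.filter (fun e => snd e = v), (Pl j e 1 + w e 1 • π (.inl v)) +
      if ∃ e, fst e = v ∨ snd e = v then 0 else π (.inl v))
    (fun e => C e j 1 • π (.inl (fst e)) + S e j 1 • π (.inr e) - π (.inl (snd e)))
  have hLv (j ξ v) : L j ξ (.inl v) =
      ∑ e ∈ univ.filter (fun e => fst e = v), (P ξ j e 0 + w e 0 * ξ (.inl v)) -
      ∑ e ∈ univ.filter (fun e => snd e = v), (P ξ j e 1 + w e 1 * ξ (.inl v)) +
      if ∃ e, fst e = v ∨ snd e = v then 0 else ξ (.inl v) := by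
    simp only [L, Pl, π, P, LinearMap.pi_apply, Sum.elim_inl, LinearMap.add_apply,
      LinearMap.sub_apply, LinearMap.sum_apply, LinearMap.smul_apply, LinearMap.proj_apply,
      smul_eq_mul]
    split_ifs <;> simp [mul_comm]
  have hLe (j ξ e) : L j ξ (.inr e) = Z ξ j e 1 - ξ (.inl (snd e)) := by
    simp [L, π, Z, mul_comm]
  have hslice {f : J → ℝ → ℝ} (hf : Continuous fun s : J × ℝ => f s.1 s.2) (x : ℝ) :
      Continuous fun j => f j x := hf.comp (Continuous.prodMk_left x)
  have hPc (ξ e x) : Continuous fun j => P ξ j e x :=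
    (continuous_const.mul (hslice (hD e) x)).add (continuous_const.mul (hslice (hR e) x))
  have hZc (ξ e x) : Continuous fun j => Z ξ j e x :=
    (continuous_const.mul (hslice (hC e) x)).add (continuous_const.mul (hslice (hS e) x))
  have hLc (ξ) : Continuous fun j => L j ξ := by
    refine continuous_pi ?_
    rintro (v | e)
    · simp only [hLv]
      exact ((continuous_finsetSum _ fun e _ => (hPc ξ e 0).add continuous_const).sub
        (continuous_finsetSum _ fun e _ => (hPc ξ e 1).add continuous_const)).add continuous_const
    · simp only [hLe]
      exact (hZc ξ e 1).sub continuous_const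
  have hLinj (j ξ) (h : L j ξ = 0) : ξ = 0 := by
    have hsol : IsReducedGraphSolution fst snd w φ K (m j) 0 (Z ξ j) (P ξ j)
        (fun v => ξ (.inl v)) := by
      refine ⟨hedge ξ j, hZ0 ξ j, fun e => sub_eq_zero.1 ((hLe j ξ e).symm.trans (by rw [h]; rfl)),
        fun v => ?_⟩
      have hv := (hLv j ξ v).symm.trans (by rw [h]; rfl : _ = (0 : ℝ))
      simp only [add_zero, sub_zero]
      split_ifs at hv with hex
      · linarith
      · push Not at hex
        rw [Finset.filter_false_of_mem fun e _ => (hex e).1,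
          Finset.filter_false_of_mem fun e _ => (hex e).2]
        simp
    have hzero : ∀ e, ∀ x ∈ Set.Icc (0 : ℝ) 1, Z ξ j e x = 0 := by
      by_contra! hne
      obtain ⟨e, x, hx, hne⟩ := hne
      exact hm j ⟨_, _, hsol.isStandardSolution hq hG, e, x, hx,
        mul_ne_zero ((hG e).pos x).ne' hne⟩
    ext (v | e)
    · by_cases hex : ∃ e, fst e = v ∨ snd e = v
      · obtain ⟨e, rfl | rfl⟩ := hex
        · exact (hsol.left e).symm.trans (hzero e 0 (by simp))
        · exact (hsol.right e).symm.trans (hzero e 1 (by simp))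
      · have hv := (hLv j ξ v).symm.trans (by rw [h]; rfl : _ = (0 : ℝ))
        rw [if_neg hex] at hv
        push Not at hex
        rw [Finset.filter_false_of_mem fun e _ => (hex e).1,
          Finset.filter_false_of_mem fun e _ => (hex e).2] at hv
        simpa using hv
    · exact (hP0 ξ j e).symm.trans ((hedge ξ j e).snd_left_eq_zero (hG e) (hzero e))
  obtain ⟨ξ, hξc, hξ⟩ := exists_continuous_forall_apply_eq L hLc hLinj
    (Sum.elim (fun v => -∑ e ∈ univ.filter (fun e => fst e = v), (1 : ℝ) -
      ∑ e ∈ univ.filter (fun e => snd e = v), (1 : ℝ)) 0)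
  refine ⟨fun j => Z (ξ j) j, fun j => P (ξ j) j, fun j v => ξ j (.inl v), fun e => ?_,
    fun j => ⟨hedge _ j, hZ0 _ j, fun e => ?_, fun v => ?_⟩⟩
  · have hξi (i) : Continuous fun s : J × ℝ => ξ s.1 i :=
      (continuous_apply i).comp (hξc.comp continuous_fst)
    exact ((hξi _).mul (hC e)).add ((hξi _).mul (hS e))
  · exact sub_eq_zero.1 ((hLe j (ξ j) e).symm.trans (by rw [hξ j]; rfl))
  · by_cases hex : ∃ e, fst e = v ∨ snd e = v
    · have hv := (hLv j (ξ j) v).symm.trans (congrFun (hξ j) (.inl v))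
      rw [if_pos hex, Sum.elim_inl] at hv
      rw [Finset.sum_add_distrib, Finset.sum_sub_distrib]
      linarith
    · push Not at hex
      rw [Finset.filter_false_of_mem fun e _ => (hex e).1,
        Finset.filter_false_of_mem fun e _ => (hex e).2]
      simp

/-- In the absence of negative eigenvalues the problem with unit sources has a positive solution
for every negative value of the parameter. -/
theorem exists_pos_isReducedGraphSolution [Fintype V]
    (hq : ∀ e, IntegrableOn (q e) (Set.Icc 0 1)) (hG : ∀ e, IsGauge (q e) K (w e) (φ e))
    (hnonneg : ∀ μ, IsEigenvalue fst snd q μ → 0 ≤ μ) (hμ : μ < 0) :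
    ∃ z p Y, IsReducedGraphSolution fst snd w φ K μ 1 z p Y ∧
      ∀ e, ∀ x ∈ Set.Icc (0 : ℝ) 1, 0 < z e x := by
  have hB (e : Fin N) : ∃ B : ℝ, ∀ x ∈ Set.Icc (0 : ℝ) 1, w e x ^ 2 ≤ B := by
    have := (hG e).continuous_w
    obtain ⟨B, hB⟩ := isCompact_Icc.exists_bound_of_continuousOn (s := Set.Icc (0 : ℝ) 1)
      (f := fun x => w e x ^ 2) (by fun_prop)
    exact ⟨B, fun x hx => (le_abs_self _).trans (hB x hx)⟩
  choose B hB using hB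
  obtain ⟨M, hM⟩ := Finite.exists_le B
  set μ₀ := min μ (-K - M - 1) with hμ₀
  have hle : μ₀ ≤ μ := min_le_left _ _
  have hμ₀' : μ₀ ≤ -K - M - 1 := min_le_right _ _
  let m : C(Set.Icc μ₀ μ, ℝ) := ⟨Subtype.val, continuous_subtype_val⟩
  obtain ⟨z, p, Y, hzc, hsol⟩ := exists_continuous_isReducedGraphSolution (w := w) (φ := φ) m hq hG
    fun j hj => ((j.2.2.trans_lt hμ).not_ge (hnonneg _ hj))
  let jl : Set.Icc μ₀ μ := ⟨μ₀, le_rfl, hle⟩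
  let jr : Set.Icc μ₀ μ := ⟨μ, hle, le_rfl⟩
  refine ⟨z jr, p jr, Y jr, hsol jr, ?_⟩
  by_contra! hne
  obtain ⟨e₁, x₁, hx₁, hne⟩ := hne
  have : Nonempty (Fin N) := ⟨e₁⟩
  have hposl (e : Fin N) (x : ℝ) (hx : x ∈ Set.Icc (0 : ℝ) 1) : 0 < z jl e x :=
    (hsol jl).pos_of_supersolution hG (fun e x hx => by
      have := (hB e x hx).trans (hM e)
      change 0 < -μ₀ - K - w e x ^ 2
      linarith) e hx
  let f (j : Set.Icc μ₀ μ) (s : Fin N × ℝ) : ℝ := z j s.1 s.2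
  have hf : Continuous fun s : Set.Icc μ₀ μ × (Fin N × ℝ) => f s.1 s.2 := by
    have : Continuous fun s : Fin N × (Set.Icc μ₀ μ × ℝ) => z s.2.1 s.1 s.2.2 :=
      continuous_prod_of_discrete_left.2 fun e => hzc e
    exact this.comp (by fun_prop :
      Continuous fun s : Set.Icc μ₀ μ × (Fin N × ℝ) => (s.2.1, (s.1, s.2.2)))
  let S : Set (Fin N × ℝ) := Set.univ ×ˢ Set.Icc (0 : ℝ) 1
  have hS : IsCompact S := isCompact_univ.prod isCompact_Icc
  have hSne : S.Nonempty := ⟨(e₁, x₁), Set.mem_univ _, hx₁⟩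
  have hleast (j) : IsLeast (f j '' S) (sInf (f j '' S)) :=
    (hS.image (hf.comp (Continuous.prodMk_right j))).isLeast_sInf (hSne.image _)
  have hg := hS.continuous_sInf (f := f) hf
  have : PreconnectedSpace (Set.Icc μ₀ μ) := Subtype.preconnectedSpace isPreconnected_Icc
  obtain ⟨j, hj⟩ := mem_range_of_exists_le_of_exists_ge hg (c := (0 : ℝ))
    ⟨jr, ((hleast jr).2 ⟨(e₁, x₁), ⟨Set.mem_univ _, hx₁⟩, rfl⟩).trans hne⟩
    ⟨jl, by
      obtain ⟨s, hs, hs'⟩ := (hleast jl).1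
      rw [← hs']
      exact (hposl s.1 s.2 hs.2).le⟩
  have hjl := hleast j
  beta_reduce at hj
  rw [hj] at hjl
  obtain ⟨⟨s, hs, hs'⟩, hlow⟩ := hjl
  have := (hsol j).pos_of_nonneg hG
    (fun e x hx => hlow ⟨(e, x), ⟨Set.mem_univ _, hx⟩, rfl⟩) s.1 hs.2
  exact this.ne' hs'

end Graph

/-- A continuous function which is approximated in mean square by constants is constant. -/
theorem eq_const_of_forall_exists_integral_sq_le {Q : ℝ → ℝ} (hQ : ContinuousOn Q (Set.Icc 0 1))
    {C : ℝ} (h : ∀ δ ∈ Set.Ioo (0 : ℝ) 1, ∃ c, ∫ x in (0 : ℝ)..1, (Q x + c) ^ 2 ≤ C * δ) {x : ℝ}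
    (hx : x ∈ Set.Icc (0 : ℝ) 1) : Q x = Q 0 := by
  set a := ∫ x in (0 : ℝ)..1, Q x with ha
  have hQi : IntervalIntegrable Q volume 0 1 := hQ.intervalIntegrable_of_Icc zero_le_one
  have hQ2 (c : ℝ) : IntervalIntegrable (fun x => (Q x + c) ^ 2) volume 0 1 :=
    ((hQ.add continuousOn_const).pow 2).intervalIntegrable_of_Icc zero_le_one
  have hvar (c : ℝ) : ∫ x in (0 : ℝ)..1, (Q x + -a) ^ 2 ≤ ∫ x in (0 : ℝ)..1, (Q x + c) ^ 2 := by
    have h1 : ∫ x in (0 : ℝ)..1, (Q x + c) ^ 2 =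
        ∫ x in (0 : ℝ)..1, ((Q x + -a) ^ 2 + (2 * (c + a) * Q x + (c ^ 2 - a ^ 2))) := by
      refine intervalIntegral.integral_congr fun x _ => ?_
      ring
    rw [h1, intervalIntegral.integral_add (hQ2 _) ((hQi.const_mul _).add (by simp)),
      intervalIntegral.integral_add (hQi.const_mul _) (by simp),
      intervalIntegral.integral_const_mul, ← ha]
    simp only [intervalIntegral.integral_const, sub_zero, smul_eq_mul, one_mul]
    nlinarith [sq_nonneg (c + a)]
  have hle : ∫ x in (0 : ℝ)..1, (Q x + -a) ^ 2 ≤ 0 := by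
    have hlim : Filter.Tendsto (fun δ : ℝ => C * δ) (nhdsWithin 0 (Set.Ioi 0)) (nhds 0) := by
      have : Continuous fun δ : ℝ => C * δ := by fun_prop
      simpa using (this.tendsto 0).mono_left nhdsWithin_le_nhds
    refine ge_of_tendsto hlim ?_
    filter_upwards [Ioo_mem_nhdsGT zero_lt_one] with δ hδ
    obtain ⟨c, hc⟩ := h δ hδ
    exact (hvar c).trans hc
  have hconst : ∀ t ∈ Set.Icc (0 : ℝ) 1, Q t = a := by
    by_contra! hne
    obtain ⟨t, ht, hne⟩ := hne
    have := intervalIntegral.integral_pos zero_lt_one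
      ((hQ.add (continuousOn_const (c := -a))).pow 2) (fun x _ => sq_nonneg _)
      ⟨t, ht, by
        have : Q t + -a ≠ 0 := by rwa [← sub_eq_add_neg, sub_ne_zero]
        change 0 < (Q t + -a) ^ 2
        positivity⟩
    exact this.not_ge hle
  rw [hconst x hx, hconst 0 (by simp)]

/-- If the primitive of an integrable function vanishes on `[0, 1]`, so does the function. -/
theorem ae_eq_zero_of_forall_integral_eq_zero {f : ℝ → ℝ} (hf : IntegrableOn f (Set.Icc 0 1))
    (h : ∀ x ∈ Set.Icc (0 : ℝ) 1, ∫ t in (0 : ℝ)..x, f t = 0) :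
    ∀ᵐ x ∂(volume.restrict (Set.Icc (0 : ℝ) 1)), f x = 0 := by
  have hf' : IntervalIntegrable f volume 0 1 :=
    (intervalIntegrable_iff_integrableOn_Icc_of_le zero_le_one).2 hf
  rw [← Measure.restrict_congr_set Ioo_ae_eq_Icc, ae_restrict_iff' measurableSet_Ioo]
  filter_upwards [hf'.ae_hasDerivAt_integral] with x hx hx01
  rw [Set.uIcc_of_le zero_le_one] at hx
  refine (hx ⟨hx01.1.le, hx01.2.le⟩ 0 (by simp)).unique
    ((hasDerivAt_const x (0 : ℝ)).congr_of_eventuallyEq ?_)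
  filter_upwards [Icc_mem_nhds hx01.1 hx01.2] with t ht using h t ht

/-- If the Schrödinger operator `-y'' + q y` with standard conditions on a compact
metric graph has all eigenvalues nonnegative, `0` is an eigenvalue, and
`∫_G q = 0`, then `q = 0` a.e. on `G` and the constant function `1` is an
eigenfunction for the eigenvalue `0`. -/
theorem potential_zero_of_zero_smallest_eigenvalue
    {V : Type} [Fintype V] [DecidableEq V] {N : ℕ}
    (fst snd : Fin N → V) (q : Fin N → ℝ → ℝ)
    (hq : ∀ e, IntegrableOn (q e) (Set.Icc 0 1))
    (hint : ∑ e, ∫ t in (0:ℝ)..1, q e t = 0)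
    (hnonneg : ∀ μ, IsEigenvalue fst snd q μ → 0 ≤ μ)
    (hzero : IsEigenvalue fst snd q 0) :
    (∀ e, ∀ᵐ x ∂(volume.restrict (Set.Icc (0:ℝ) 1)), q e x = 0) ∧
      IsStandardSolution fst snd q 0 (fun _ _ => 1) (fun _ _ => 0) := by
  choose K₀ hK₀ using fun e => exists_isGauge (hq e)
  obtain ⟨K, hK⟩ := Finite.exists_le K₀
  choose w φ hG using fun e => hK₀ e K (hK e)
  have hprim : ∀ e, ∀ x ∈ Set.Icc (0 : ℝ) 1, ∫ t in (0 : ℝ)..x, q e t = 0 := by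
    intro e x hx
    have hqi : IntervalIntegrable (q e) volume 0 1 :=
      (intervalIntegrable_iff_integrableOn_Icc_of_le zero_le_one).2 (hq e)
    have hQ : ContinuousOn (fun x => ∫ t in (0 : ℝ)..x, q e t) (Set.Icc 0 1) := by
      simpa using intervalIntegral.continuousOn_primitive_interval' hqi Set.left_mem_uIcc
    have := eq_const_of_forall_exists_integral_sq_le hQ (C := 2 * N + 2 * (1 + N) ^ 2)
      (fun δ hδ => ?_) hx
    · simpa using this
    obtain ⟨z, p, Y, hsol, hz⟩ :=
      exists_pos_isReducedGraphSolution hq hG hnonneg (neg_lt_zero.2 hδ.1)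
    obtain ⟨W, hWc, hW, hWle⟩ := hsol.exists_riccati hG hz hint
    rw [neg_neg] at hWle
    have hWi : IntervalIntegrable (fun t => W e t ^ 2) volume 0 1 :=
      ((hWc e).pow 2).intervalIntegrable_of_Icc zero_le_one
    have hWe : ∫ t in (0 : ℝ)..1, W e t ^ 2 ≤ δ * N :=
      (Finset.single_le_sum (f := fun e => ∫ t in (0 : ℝ)..1, W e t ^ 2)
        (fun e _ => intervalIntegral.integral_nonneg zero_le_one fun t _ => sq_nonneg _)
        (Finset.mem_univ e)).trans hWle
    refine ⟨W e 0, ?_⟩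
    calc ∫ x in (0 : ℝ)..1, ((∫ t in (0 : ℝ)..x, q e t) + W e 0) ^ 2
        ≤ ∫ x in (0 : ℝ)..1, (2 * W e x ^ 2 + 2 * (δ * (1 + N)) ^ 2) := by
          refine intervalIntegral.integral_mono_on zero_le_one
            (((hQ.add continuousOn_const).pow 2).intervalIntegrable_of_Icc zero_le_one)
            ((hWi.const_mul 2).add (by simp)) fun t ht => ?_
          have h1 := hW e t ht
          have h2 : 0 ≤ ∫ s in (0 : ℝ)..t, W e s ^ 2 :=
            intervalIntegral.integral_nonneg ht.1 fun s _ => sq_nonneg _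
          have h3 : ∫ s in (0 : ℝ)..t, W e s ^ 2 ≤ δ * N :=
            (intervalIntegral.integral_mono_interval le_rfl ht.1 ht.2
              (ae_of_all _ fun s => sq_nonneg (W e s)) hWi).trans hWe
          have h4 : 0 ≤ δ * t := mul_nonneg hδ.1.le ht.1
          have h5 : δ * t ≤ δ := mul_le_of_le_one_right hδ.1.le ht.2
          have h6 : (δ * t - ∫ s in (0 : ℝ)..t, W e s ^ 2) ^ 2 ≤ (δ * (1 + N)) ^ 2 := by
            refine sq_le_sq' ?_ ?_ <;> nlinarith
          have h7 : (∫ s in (0 : ℝ)..t, q e s) + W e 0 =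
              W e t - (δ * t - ∫ s in (0 : ℝ)..t, W e s ^ 2) := by linarith
          rw [h7]
          nlinarith [sq_nonneg (W e t + (δ * t - ∫ s in (0 : ℝ)..t, W e s ^ 2))]
      _ = 2 * (∫ x in (0 : ℝ)..1, W e x ^ 2) + 2 * (δ * (1 + N)) ^ 2 := by
          rw [intervalIntegral.integral_add (hWi.const_mul 2) (by simp),
            intervalIntegral.integral_const_mul]
          simp
      _ ≤ 2 * (δ * N) + 2 * (δ * (1 + N) ^ 2) := by
          have : (δ * (1 + N)) ^ 2 ≤ δ * (1 + N) ^ 2 := by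
            rw [mul_pow]
            refine mul_le_mul_of_nonneg_right ?_ (by positivity)
            nlinarith [hδ.1, hδ.2]
          linarith
      _ = (2 * N + 2 * (1 + N) ^ 2) * δ := by ring
  refine ⟨fun e => ae_eq_zero_of_forall_integral_eq_zero (hq e) (hprim e), by simp,
    fun e x hx => ?_, ⟨fun _ => 1, by simp⟩, by simp⟩
  simpa using (hprim e x hx).symm
end
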